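/- For every pyramid partition Π = (Π_B, Π_W) of length m, every pole of the rational function h_Π(z) ∈ K(z) lies in the set { x_p : p is an addible or removable pair of Π }; that is, there exist a polynomial P ∈ K[z] and natural numbers n_p ≥ 0 such that h_Π(z) = P(z) / ∏_{p ∈ AddP(Π) ∪ RemP(Π)} (z − x_p)^{n_p}. -/

import Mathlib

/-- A stone position `(a,b,j)` in the pyramid. -/
abbrev PyrPos : Type := ℕ × ℕ × ℕ

/-- `(a,b,j)` is a black position of the length-`m` empty room configuration:
`a + b ≤ j ≤ m − 1`. -/
def IsBlackPos (m : ℕ) (p : PyrPos) : Prop :=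
  p.1 + p.2.1 ≤ p.2.2 ∧ p.2.2 ≤ m - 1

/-- `(a,b,j)` is a white position of the length-`m` empty room configuration:
`a + b < j ≤ m − 1`. -/
def IsWhitePos (m : ℕ) (p : PyrPos) : Prop :=
  p.1 + p.2.1 < p.2.2 ∧ p.2.2 ≤ m - 1

/-- `(ΠB, ΠW)` is a pyramid partition of length `m`. -/
def IsPyramid (m : ℕ) (PB PW : Finset PyrPos) : Prop :=
  (∀ p ∈ PB, IsBlackPos m p) ∧
  (∀ p ∈ PW, IsWhitePos m p) ∧
  (∀ p ∈ PB, 1 ≤ p.1 → (p.1 - 1, p.2.1, p.2.2) ∈ PW) ∧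
  (∀ p ∈ PB, 1 ≤ p.2.1 → (p.1, p.2.1 - 1, p.2.2) ∈ PW) ∧
  (∀ p ∈ PW, p ∈ PB ∧ (p.1, p.2.1, p.2.2 - 1) ∈ PB)

/-- The field `K = ℚ(q, h, χ)` of rational functions in three indeterminates. -/
abbrev KP : Type := FractionRing (MvPolynomial (Fin 3) ℚ)

/-- The equivariant parameter `q`. -/
noncomputable def qP : KP := algebraMap (MvPolynomial (Fin 3) ℚ) KP (MvPolynomial.X 0)

/-- The equivariant parameter `h`. -/
noncomputable def hP : KP := algebraMap (MvPolynomial (Fin 3) ℚ) KP (MvPolynomial.X 1)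

/-- The framing parameter `χ`. -/
noncomputable def chiP : KP := algebraMap (MvPolynomial (Fin 3) ℚ) KP (MvPolynomial.X 2)

/-- The parameter `t := −q − h` (so `t + q + h = 0`). -/
noncomputable def tP : KP := -qP - hP

/-- The weight `x_p = χ + a·q + b·h + j·t` of a position `p = (a,b,j)`. -/
noncomputable def posWeight (p : PyrPos) : KP :=
  chiP + (p.1 : KP) * qP + (p.2.1 : KP) * hP + (p.2.2 : KP) * tP

/-- The set of addible pairs of the pyramid partition `(ΠB, ΠW)`. -/
def AddPairs (m : ℕ) (PB PW : Finset PyrPos) : Set PyrPos :=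
  { p | IsWhitePos m p ∧ p ∉ PB ∧ IsPyramid m (insert p PB) (insert p PW) }

/-- The set of removable pairs of the pyramid partition `(ΠB, ΠW)`. -/
def RemPairs (m : ℕ) (PB PW : Finset PyrPos) : Set PyrPos :=
  { p | p ∈ PW ∧ IsPyramid m (PB.erase p) (PW.erase p) }

/-- The rational function `h_Π(z) ∈ K(z)` attached to a pyramid partition
`Π = (ΠB, ΠW)` of length `m`. -/
noncomputable def hPyr (m : ℕ) (PB PW : Finset PyrPos) : RatFunc KP :=
  (-1 : RatFunc KP) ^ (PB \ PW).card * (-1 : RatFunc KP) ^ (m + 1) *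
    (RatFunc.X - RatFunc.C chiP - RatFunc.C ((m : KP) * tP)) *
    (∏ p ∈ PW,
      ((RatFunc.X - RatFunc.C (posWeight p) + RatFunc.C tP) *
        (RatFunc.X - RatFunc.C (posWeight p) + RatFunc.C qP) *
        (RatFunc.X - RatFunc.C (posWeight p) + RatFunc.C hP)) /
      ((RatFunc.X - RatFunc.C (posWeight p) - RatFunc.C tP) *
        (RatFunc.X - RatFunc.C (posWeight p) - RatFunc.C qP) *
        (RatFunc.X - RatFunc.C (posWeight p) - RatFunc.C hP))) *
    ∏ p ∈ PB \ PW,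
      ((RatFunc.X - RatFunc.C (posWeight p)) *
        (RatFunc.X - RatFunc.C (posWeight p) + RatFunc.C qP) *
        (RatFunc.X - RatFunc.C (posWeight p) + RatFunc.C hP)) /
      (RatFunc.X - RatFunc.C (posWeight p) - RatFunc.C tP)

/-- A set of positions closed under the diagonal shift `(a+1,b+1,j+1) ↦ (a,b,j)`. -/
def DiagClosed (S : Finset PyrPos) : Prop :=
  ∀ a b j, (a + 1, b + 1, j) ∈ S → ∃ i, j = i + 1 ∧ (a, b, i) ∈ S

/-- The number of positions `(a,b,j) ∈ S` with `j - a = α` and `j - b = β`; these are the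
positions of `S` with weight `χ - α q - β h`. -/
def lineCount (S : Finset PyrPos) (α β : ℤ) : ℕ :=
  (S.filter fun p => (p.2.2 : ℤ) - p.1 = α ∧ (p.2.2 : ℤ) - p.2.1 = β).card

theorem Finset.mem_iff_lt_card_of_succ_mem {T : Finset ℕ} (hT : ∀ k, k + 1 ∈ T → k ∈ T) (k : ℕ) :
    k ∈ T ↔ k < T.card := by
  have hle : ∀ i l, i + l ∈ T → i ∈ T := by
    intro i l
    induction l with
    | zero => exact id
    | succ l ih => exact fun h => ih (hT _ h)
  constructor
  · intro hk
    have hsub : Finset.range (k + 1) ⊆ T := by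
      intro i hi
      refine hle i (k - i) ?_
      rwa [Nat.add_sub_cancel' (by simpa [Nat.lt_succ_iff] using hi)]
    simpa using Finset.card_le_card hsub
  · intro hk
    by_contra hnot
    have hsub : T ⊆ Finset.range k := by
      intro i hi
      by_contra hik
      refine hnot (hle k (i - k) ?_)
      rwa [Nat.add_sub_cancel' (by simpa using hik)]
    have := Finset.card_le_card hsub
    rw [Finset.card_range] at this
    omega

theorem DiagClosed.lt_lineCount_iff {S : Finset PyrPos} (hS : DiagClosed S) (α β : ℤ) (k : ℕ) :
    k < lineCount S α β ↔
      ∃ a b j : ℕ, (a, b, j) ∈ S ∧ (j : ℤ) - a = α ∧ (j : ℤ) - b = β ∧ min a b = k := by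
  set L := S.filter fun p => (p.2.2 : ℤ) - p.1 = α ∧ (p.2.2 : ℤ) - p.2.1 = β with hL
  have hinj : Set.InjOn (fun p : PyrPos => min p.1 p.2.1) L := by
    rintro ⟨a, b, j⟩ hp ⟨a', b', j'⟩ hp' h
    simp only [hL, Finset.coe_filter, Set.mem_ofPred_eq] at hp hp' h
    simp only [Prod.mk.injEq]
    omega
  have hmem : ∀ k, k ∈ L.image (fun p : PyrPos => min p.1 p.2.1) ↔
      ∃ a b j : ℕ, (a, b, j) ∈ S ∧ (j : ℤ) - a = α ∧ (j : ℤ) - b = β ∧ min a b = k := by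
    intro k
    simp [hL, and_assoc]
  rw [← hmem, Finset.mem_iff_lt_card_of_succ_mem, Finset.card_image_of_injOn hinj]
  · rfl
  · intro k
    rw [hmem, hmem]
    rintro ⟨a, b, j, hp, h1, h2, h3⟩
    obtain ⟨a, rfl⟩ : ∃ a', a = a' + 1 := ⟨a - 1, by omega⟩
    obtain ⟨b, rfl⟩ : ∃ b', b = b' + 1 := ⟨b - 1, by omega⟩
    obtain ⟨i, rfl, hi⟩ := hS _ _ _ hp
    exact ⟨a, b, i, hi, by omega, by omega, by omega⟩

theorem DiagClosed.mem_iff {S : Finset PyrPos} (hS : DiagClosed S) {a b j : ℕ} {α β : ℤ}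
    (hα : (j : ℤ) - a = α) (hβ : (j : ℤ) - b = β) :
    (a, b, j) ∈ S ↔ min a b < lineCount S α β := by
  rw [hS.lt_lineCount_iff]
  constructor
  · exact fun h => ⟨a, b, j, h, hα, hβ, rfl⟩
  · rintro ⟨a', b', j', h, h1, h2, h3⟩
    obtain rfl : a' = a := by omega
    obtain rfl : b' = b := by omega
    obtain rfl : j' = j := by omega
    exact h

namespace IsPyramid

variable {m : ℕ} {PB PW : Finset PyrPos}

theorem black_le (h : IsPyramid m PB PW) {a b j : ℕ} (hp : (a, b, j) ∈ PB) :
    a + b ≤ j ∧ j ≤ m - 1 := h.1 _ hp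

theorem white_lt (h : IsPyramid m PB PW) {a b j : ℕ} (hp : (a, b, j) ∈ PW) :
    a + b < j ∧ j ≤ m - 1 := h.2.1 _ hp

theorem white_of_black_left (h : IsPyramid m PB PW) {a b j : ℕ} (hp : (a + 1, b, j) ∈ PB) :
    (a, b, j) ∈ PW := h.2.2.1 _ hp (Nat.succ_pos a)

theorem white_of_black_right (h : IsPyramid m PB PW) {a b j : ℕ} (hp : (a, b + 1, j) ∈ PB) :
    (a, b, j) ∈ PW := h.2.2.2.1 _ hp (Nat.succ_pos b)

theorem black_of_white (h : IsPyramid m PB PW) {a b j : ℕ} (hp : (a, b, j) ∈ PW) :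
    (a, b, j) ∈ PB := (h.2.2.2.2 _ hp).1

theorem black_of_white_succ (h : IsPyramid m PB PW) {a b j : ℕ} (hp : (a, b, j + 1) ∈ PW) :
    (a, b, j) ∈ PB := (h.2.2.2.2 _ hp).2

theorem diagClosed_black (h : IsPyramid m PB PW) : DiagClosed PB := by
  intro a b j hp
  obtain ⟨i, rfl⟩ : ∃ i, j = i + 1 := ⟨j - 1, by have := h.black_le hp; omega⟩
  exact ⟨i, rfl, h.black_of_white_succ
    (h.white_of_black_right (h.black_of_white (h.white_of_black_left hp)))⟩

theorem diagClosed_white (h : IsPyramid m PB PW) : DiagClosed PW := by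
  intro a b j hp
  obtain ⟨i, rfl⟩ : ∃ i, j = i + 1 := ⟨j - 1, by have := h.white_lt hp; omega⟩
  exact ⟨i, rfl, h.white_of_black_right
    (h.black_of_white (h.white_of_black_left (h.black_of_white_succ hp)))⟩

theorem lineCount_black_le_left (h : IsPyramid m PB PW) (α β : ℤ) :
    lineCount PB α β ≤ lineCount PW (α + 1) β + 1 ∧
      (α < β → lineCount PB α β ≤ lineCount PW (α + 1) β) := by
  have key : ∀ k, lineCount PW (α + 1) β + k < lineCount PB α β → ¬(α < β ∨ 1 ≤ k) := by
    intro k hk hor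
    obtain ⟨a, b, j, hp, h1, h2, h3⟩ := (h.diagClosed_black.lt_lineCount_iff _ _ _).1 hk
    obtain ⟨a, rfl⟩ : ∃ a', a = a' + 1 := ⟨a - 1, by omega⟩
    have := (h.diagClosed_white.mem_iff (α := α + 1) (β := β) (by omega) (by omega)).1
      (h.white_of_black_left hp)
    omega
  have h0 := key 0
  have h1 := key 1
  omega

theorem lineCount_black_le_right (h : IsPyramid m PB PW) (α β : ℤ) :
    lineCount PB α β ≤ lineCount PW α (β + 1) + 1 ∧
      (β < α → lineCount PB α β ≤ lineCount PW α (β + 1)) := by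
  have key : ∀ k, lineCount PW α (β + 1) + k < lineCount PB α β → ¬(β < α ∨ 1 ≤ k) := by
    intro k hk hor
    obtain ⟨a, b, j, hp, h1, h2, h3⟩ := (h.diagClosed_black.lt_lineCount_iff _ _ _).1 hk
    obtain ⟨b, rfl⟩ : ∃ b', b = b' + 1 := ⟨b - 1, by omega⟩
    have := (h.diagClosed_white.mem_iff (α := α) (β := β + 1) (by omega) (by omega)).1
      (h.white_of_black_right hp)
    omega
  have h0 := key 0
  have h1 := key 1
  omega

theorem lineCount_white_le (h : IsPyramid m PB PW) (α β : ℤ) :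
    lineCount PW α β ≤ lineCount PB α β := by
  by_contra hlt
  obtain ⟨a, b, j, hp, h1, h2, h3⟩ := (h.diagClosed_white.lt_lineCount_iff _ _ _).1 (not_le.1 hlt)
  have := (h.diagClosed_black.mem_iff h1 h2).1 (h.black_of_white hp)
  omega

theorem lineCount_white_le_sub (h : IsPyramid m PB PW) (α β : ℤ) :
    lineCount PW α β ≤ lineCount PB (α - 1) (β - 1) := by
  by_contra hlt
  obtain ⟨a, b, j, hp, h1, h2, h3⟩ := (h.diagClosed_white.lt_lineCount_iff _ _ _).1 (not_le.1 hlt)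
  obtain ⟨i, rfl⟩ : ∃ i, j = i + 1 := ⟨j - 1, by have := h.white_lt hp; omega⟩
  have := (h.diagClosed_black.mem_iff (α := α - 1) (β := β - 1) (by omega) (by omega)).1
    (h.black_of_white_succ hp)
  omega

/-- The position after the last white one on a line is addible when the stones it rests on
are present and it is not yet occupied. -/
theorem mem_addPairs (h : IsPyramid m PB PW) {a b j : ℕ} (hj : j + 1 ≤ m - 1)
    (hnot : (a, b, j + 1) ∉ PB) (hbelow : (a, b, j) ∈ PB)
    (hleft : ∀ a', a = a' + 1 → (a', b, j + 1) ∈ PW)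
    (hright : ∀ b', b = b' + 1 → (a, b', j + 1) ∈ PW) :
    (a, b, j + 1) ∈ AddPairs m PB PW := by
  have hle := h.black_le hbelow
  have hw : IsWhitePos m (a, b, j + 1) := ⟨Nat.lt_succ_of_le hle.1, hj⟩
  refine ⟨hw, hnot, ?_, ?_, ?_, ?_, ?_⟩
  · intro p hp
    rcases Finset.mem_insert.1 hp with rfl | hp
    · exact ⟨hw.1.le, hw.2⟩
    · exact h.1 p hp
  · intro p hp
    rcases Finset.mem_insert.1 hp with rfl | hp
    · exact hw
    · exact h.2.1 p hp
  · intro p hp hpos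
    apply Finset.mem_insert_of_mem
    rcases Finset.mem_insert.1 hp with rfl | hp
    · exact hleft _ (Nat.sub_add_cancel hpos).symm
    · exact h.2.2.1 p hp hpos
  · intro p hp hpos
    apply Finset.mem_insert_of_mem
    rcases Finset.mem_insert.1 hp with rfl | hp
    · exact hright _ (Nat.sub_add_cancel hpos).symm
    · exact h.2.2.2.1 p hp hpos
  · intro p hp
    rcases Finset.mem_insert.1 hp with rfl | hp
    · exact ⟨Finset.mem_insert_self _ _, Finset.mem_insert_of_mem hbelow⟩
    · exact ⟨Finset.mem_insert_of_mem (h.2.2.2.2 p hp).1,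
        Finset.mem_insert_of_mem (h.2.2.2.2 p hp).2⟩

/-- A white position is removable when no stone rests on it. -/
theorem mem_remPairs (h : IsPyramid m PB PW) {a b j : ℕ} (hp : (a, b, j) ∈ PW)
    (hleft : (a + 1, b, j) ∉ PB) (hright : (a, b + 1, j) ∉ PB) (habove : (a, b, j + 1) ∉ PW) :
    (a, b, j) ∈ RemPairs m PB PW := by
  refine ⟨hp, ?_, ?_, ?_, ?_, ?_⟩
  · exact fun p hp => h.1 p (Finset.mem_of_mem_erase hp)
  · exact fun p hp => h.2.1 p (Finset.mem_of_mem_erase hp)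
  · rintro ⟨a', b', j'⟩ hp' hpos
    have hp' := Finset.mem_of_mem_erase hp'
    refine Finset.mem_erase.2 ⟨fun heq => hleft ?_, h.2.2.1 _ hp' hpos⟩
    simp only [Prod.mk.injEq] at heq hpos
    obtain ⟨rfl, rfl, rfl⟩ := heq
    rwa [Nat.sub_add_cancel hpos]
  · rintro ⟨a', b', j'⟩ hp' hpos
    have hp' := Finset.mem_of_mem_erase hp'
    refine Finset.mem_erase.2 ⟨fun heq => hright ?_, h.2.2.2.1 _ hp' hpos⟩
    simp only [Prod.mk.injEq] at heq hpos
    obtain ⟨rfl, rfl, rfl⟩ := heq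
    rwa [Nat.sub_add_cancel hpos]
  · rintro ⟨a', b', j'⟩ hp'
    obtain ⟨hne, hp'⟩ := Finset.mem_erase.1 hp'
    refine ⟨Finset.mem_erase.2 ⟨hne, (h.2.2.2.2 _ hp').1⟩,
      Finset.mem_erase.2 ⟨fun heq => habove ?_, (h.2.2.2.2 _ hp').2⟩⟩
    have hlt := h.white_lt hp'
    simp only [Prod.mk.injEq] at heq
    obtain ⟨rfl, rfl, rfl⟩ := heq
    rwa [Nat.sub_add_cancel (by omega)]

/-- The order of vanishing of `hPyr` at `χ - α q - β h` is nonnegative unless this is the weight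
of an addible or removable pair. -/
theorem exists_mem_addPairs_or_remPairs (h : IsPyramid m PB PW) (hm : 1 ≤ m) (α β : ℤ)
    (hneg : (if α = m ∧ β = m then 1 else 0 : ℤ) + lineCount PB α β + lineCount PB (α - 1) β
      + lineCount PB α (β - 1) - lineCount PB (α - 1) (β - 1) - lineCount PW α β
      - lineCount PW (α + 1) β - lineCount PW α (β + 1) + lineCount PW (α + 1) (β + 1) < 0) :
    ∃ a b j : ℕ, (a, b, j) ∈ AddPairs m PB PW ∪ RemPairs m PB PW ∧
      (j : ℤ) - a = α ∧ (j : ℤ) - b = β := by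
  have b1 := h.lineCount_black_le_left α β
  have b2 := h.lineCount_black_le_right α β
  have b4 := h.lineCount_black_le_right α (β - 1)
  have b5 := h.lineCount_black_le_left (α - 1) β
  have b7 := h.lineCount_black_le_left (α - 1) (β - 1)
  have b8 := h.lineCount_black_le_right (α - 1) (β - 1)
  have b9 := h.lineCount_black_le_left α (β + 1)
  have b10 := h.lineCount_black_le_right (α + 1) β
  have w1 := h.lineCount_white_le α β
  have w2 := h.lineCount_white_le (α + 1) β
  have w3 := h.lineCount_white_le α (β + 1)
  have w4 := h.lineCount_white_le (α - 1) β
  have w5 := h.lineCount_white_le α (β - 1)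
  have s1 := h.lineCount_white_le_sub α β
  have s2 := h.lineCount_white_le_sub (α + 1) β
  have s3 := h.lineCount_white_le_sub α (β + 1)
  have s4 := h.lineCount_white_le_sub (α + 1) (β + 1)
  simp only [add_sub_cancel_right, sub_add_cancel] at *
  by_cases hadd : lineCount PW α β < lineCount PB (α - 1) (β - 1)
  · obtain ⟨a, b, j, hp, h1, h2, h3⟩ := (h.diagClosed_black.lt_lineCount_iff _ _ _).1 hadd
    have hle := h.black_le hp
    have hnot : (a, b, j + 1) ∉ PB := by
      rw [h.diagClosed_black.mem_iff (α := α) (β := β) (by omega) (by omega)]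
      omega
    have hleft : ∀ a', a = a' + 1 → (a', b, j + 1) ∈ PW := by
      rintro a' rfl
      rw [h.diagClosed_white.mem_iff (α := α + 1) (β := β) (by omega) (by omega)]
      omega
    have hright : ∀ b', b = b' + 1 → (a, b', j + 1) ∈ PW := by
      rintro b' rfl
      rw [h.diagClosed_white.mem_iff (α := α) (β := β + 1) (by omega) (by omega)]
      omega
    refine ⟨a, b, j + 1, Or.inl (h.mem_addPairs ?_ hnot hp hleft hright), by omega, by omega⟩
    by_contra hj
    have ha : a = 0 := by
      by_contra ha
      have := (h.white_lt (hleft (a - 1) (by omega))).2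
      omega
    have hb : b = 0 := by
      by_contra hb
      have := (h.white_lt (hright (b - 1) (by omega))).2
      omega
    rw [if_pos (by omega)] at hneg
    omega
  · have hpos : lineCount PW α β - 1 < lineCount PW α β := by
      omega
    obtain ⟨a, b, j, hp, h1, h2, h3⟩ := (h.diagClosed_white.lt_lineCount_iff _ _ _).1 hpos
    refine ⟨a, b, j, Or.inr (h.mem_remPairs hp ?_ ?_ ?_), h1, h2⟩
    · rw [h.diagClosed_black.mem_iff (α := α - 1) (β := β) (by omega) (by omega)]
      omega
    · rw [h.diagClosed_black.mem_iff (α := α) (β := β - 1) (by omega) (by omega)]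
      omega
    · rw [h.diagClosed_white.mem_iff (α := α + 1) (β := β + 1) (by omega) (by omega)]
      omega

end IsPyramid

/-- The pair `(j - a, j - b)` determining the weight of the position `(a,b,j)`. -/
def lineClass (p : PyrPos) : ℤ × ℤ := ((p.2.2 : ℤ) - p.1, (p.2.2 : ℤ) - p.2.1)

/-- The linear factor `z - (χ - α q - β h)`. -/
noncomputable def lineFactor (u : ℤ × ℤ) : RatFunc KP :=
  RatFunc.X - RatFunc.C (chiP - (u.1 : KP) * qP - (u.2 : KP) * hP)

/-- The product of the linear factors `z - (χ - α q - β h)` with exponents prescribed by `D`. -/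
noncomputable def linePow (D : ℤ × ℤ →₀ ℤ) : RatFunc KP :=
  D.prod fun u n => lineFactor u ^ n

/-- The formal sum over `p ∈ S` of the class of `p` shifted by `e`. -/
noncomputable def lineDivisor (S : Finset PyrPos) (e : ℤ × ℤ) : ℤ × ℤ →₀ ℤ :=
  ∑ p ∈ S, Finsupp.single (lineClass p + e) 1

theorem RatFunc.X_sub_C_eq_algebraMap {K : Type*} [Field K] (c : K) :
    (RatFunc.X - RatFunc.C c : RatFunc K) =
      algebraMap (Polynomial K) (RatFunc K) (Polynomial.X - Polynomial.C c) := by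
  simp

theorem RatFunc.X_sub_C_ne_zero {K : Type*} [Field K] (c : K) :
    (RatFunc.X - RatFunc.C c : RatFunc K) ≠ 0 := by
  rw [RatFunc.X_sub_C_eq_algebraMap]
  exact RatFunc.algebraMap_ne_zero (Polynomial.X_sub_C_ne_zero c)

theorem lineFactor_lineClass_add (p : PyrPos) (e : ℤ × ℤ) :
    lineFactor (lineClass p + e) =
      RatFunc.X - RatFunc.C (posWeight p - (e.1 : KP) * qP - (e.2 : KP) * hP) := by
  simp only [lineFactor, lineClass, posWeight, tP, Prod.fst_add, Prod.snd_add]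
  congr 2
  push_cast
  ring

theorem linePow_add (D E : ℤ × ℤ →₀ ℤ) : linePow (D + E) = linePow D * linePow E :=
  Finsupp.prod_add_index' (fun _ => zpow_zero _)
    fun _ _ _ => zpow_add₀ (RatFunc.X_sub_C_ne_zero _) _ _

theorem linePow_single (u : ℤ × ℤ) : linePow (Finsupp.single u 1) = lineFactor u := by
  simp [linePow]

theorem linePow_ne_zero (D : ℤ × ℤ →₀ ℤ) : linePow D ≠ 0 :=
  Finset.prod_ne_zero_iff.2 fun _ _ => zpow_ne_zero _ (RatFunc.X_sub_C_ne_zero _)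

theorem linePow_sub (D E : ℤ × ℤ →₀ ℤ) : linePow (D - E) = linePow D / linePow E := by
  rw [eq_div_iff (linePow_ne_zero E), ← linePow_add, sub_add_cancel]

theorem linePow_lineDivisor (S : Finset PyrPos) (e : ℤ × ℤ) :
    linePow (lineDivisor S e) = ∏ p ∈ S, lineFactor (lineClass p + e) := by
  classical
  induction S using Finset.induction_on with
  | empty => simp [lineDivisor, linePow]
  | insert p S hp ih =>
    rw [Finset.prod_insert hp, ← ih, ← linePow_single, ← linePow_add, lineDivisor, lineDivisor,
      Finset.sum_insert hp]

theorem lineDivisor_apply (S : Finset PyrPos) (e u : ℤ × ℤ) :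
    lineDivisor S e u = lineCount S (u.1 - e.1) (u.2 - e.2) := by
  simp only [lineDivisor, lineCount, Finsupp.coe_finsetSum, Finset.sum_apply,
    Finsupp.single_apply, Finset.sum_boole]
  congr 2
  ext p
  simp only [Finset.mem_filter, lineClass, Prod.ext_iff, Prod.fst_add, Prod.snd_add,
    eq_sub_iff_add_eq]

theorem lineCount_sdiff {S T : Finset PyrPos} (h : T ⊆ S) (α β : ℤ) :
    (lineCount (S \ T) α β : ℤ) = lineCount S α β - lineCount T α β := by
  have := Finset.card_sdiff_add_card_eq_card (Finset.filter_subset_filter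
    (fun p : PyrPos => (p.2.2 : ℤ) - p.1 = α ∧ (p.2.2 : ℤ) - p.2.1 = β) h)
  have hfilter : (S \ T).filter (fun p : PyrPos => (p.2.2 : ℤ) - p.1 = α ∧ (p.2.2 : ℤ) - p.2.1 = β)
      = S.filter (fun p : PyrPos => (p.2.2 : ℤ) - p.1 = α ∧ (p.2.2 : ℤ) - p.2.1 = β) \
        T.filter fun p : PyrPos => (p.2.2 : ℤ) - p.1 = α ∧ (p.2.2 : ℤ) - p.2.1 = β := by
    ext p
    simp only [Finset.mem_filter, Finset.mem_sdiff]
    tauto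
  rw [lineCount, lineCount, lineCount, hfilter]
  omega

/-- The divisor of zeros and poles of `hPyr m PB PW`. -/
noncomputable def hPyrDivisor (m : ℕ) (PB PW : Finset PyrPos) : ℤ × ℤ →₀ ℤ :=
  Finsupp.single ((m : ℤ), (m : ℤ)) 1
    + (lineDivisor PW (-1, -1) + lineDivisor PW (1, 0) + lineDivisor PW (0, 1)
      - (lineDivisor PW (1, 1) + lineDivisor PW (-1, 0) + lineDivisor PW (0, -1)))
    + (lineDivisor (PB \ PW) (0, 0) + lineDivisor (PB \ PW) (1, 0) + lineDivisor (PB \ PW) (0, 1)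
      - lineDivisor (PB \ PW) (1, 1))

theorem hPyr_eq_linePow (m : ℕ) (PB PW : Finset PyrPos) :
    hPyr m PB PW = (-1) ^ (PB \ PW).card * (-1) ^ (m + 1) * linePow (hPyrDivisor m PB PW) := by
  have hprod : ∀ (S : Finset PyrPos) (e : ℤ × ℤ) (f : PyrPos → RatFunc KP),
      (∀ p, f p = lineFactor (lineClass p + e)) → linePow (lineDivisor S e) = ∏ p ∈ S, f p :=
    fun S e f hf => by
      rw [linePow_lineDivisor]
      exact Finset.prod_congr rfl fun p _ => (hf p).symm
  have ht : RatFunc.C tP = -RatFunc.C qP - RatFunc.C hP := by simp [tP]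
  rw [hPyr, hPyrDivisor, linePow_add, linePow_add, linePow_single, linePow_sub, linePow_sub]
  simp only [linePow_add, Finset.prod_div_distrib, Finset.prod_mul_distrib]
  rw [hprod PW (-1, -1) (fun p => RatFunc.X - RatFunc.C (posWeight p) + RatFunc.C tP),
    hprod PW (1, 0) (fun p => RatFunc.X - RatFunc.C (posWeight p) + RatFunc.C qP),
    hprod PW (0, 1) (fun p => RatFunc.X - RatFunc.C (posWeight p) + RatFunc.C hP),
    hprod PW (1, 1) (fun p => RatFunc.X - RatFunc.C (posWeight p) - RatFunc.C tP),
    hprod PW (-1, 0) (fun p => RatFunc.X - RatFunc.C (posWeight p) - RatFunc.C qP),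
    hprod PW (0, -1) (fun p => RatFunc.X - RatFunc.C (posWeight p) - RatFunc.C hP),
    hprod (PB \ PW) (0, 0) (fun p => RatFunc.X - RatFunc.C (posWeight p)),
    hprod (PB \ PW) (1, 0) (fun p => RatFunc.X - RatFunc.C (posWeight p) + RatFunc.C qP),
    hprod (PB \ PW) (0, 1) (fun p => RatFunc.X - RatFunc.C (posWeight p) + RatFunc.C hP),
    hprod (PB \ PW) (1, 1) (fun p => RatFunc.X - RatFunc.C (posWeight p) - RatFunc.C tP)]
  · have hfactor : lineFactor ((m : ℤ), (m : ℤ)) =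
        RatFunc.X - RatFunc.C chiP - RatFunc.C ((m : KP) * tP) := by
      simp only [lineFactor, map_sub, map_mul, ht]
      push_cast
      ring
    rw [hfactor]
    simp only [mul_assoc]
  all_goals
    intro p
    rw [lineFactor_lineClass_add]
    simp only [map_sub, map_mul, ht]
    push_cast
    simp only [map_neg, map_one, map_zero]
    ring

theorem IsPyramid.hPyrDivisor_apply {m : ℕ} {PB PW : Finset PyrPos} (h : IsPyramid m PB PW)
    (α β : ℤ) :
    hPyrDivisor m PB PW (α, β) = (if α = m ∧ β = m then 1 else 0 : ℤ) + lineCount PB α β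
      + lineCount PB (α - 1) β + lineCount PB α (β - 1) - lineCount PB (α - 1) (β - 1)
      - lineCount PW α β - lineCount PW (α + 1) β - lineCount PW α (β + 1)
      + lineCount PW (α + 1) (β + 1) := by
  have hsub : PW ⊆ PB := fun p hp => (h.2.2.2.2 p hp).1
  have hsingle : Finsupp.single ((m : ℤ), (m : ℤ)) (1 : ℤ) (α, β) =
      if α = m ∧ β = m then 1 else 0 := by
    simp [Finsupp.single_apply, eq_comm]
  simp only [hPyrDivisor, Finsupp.add_apply, Finsupp.sub_apply, lineDivisor_apply,
    lineCount_sdiff hsub, hsingle, sub_neg_eq_add, sub_zero]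
  ring

theorem finite_addPairs_union_remPairs (m : ℕ) (PB PW : Finset PyrPos) :
    (AddPairs m PB PW ∪ RemPairs m PB PW).Finite := by
  refine Set.Finite.union ?_ (PW.finite_toSet.subset fun p hp => hp.1)
  refine ((Finset.range m ×ˢ Finset.range m ×ˢ Finset.range m).finite_toSet).subset ?_
  rintro ⟨a, b, j⟩ ⟨⟨h1, h2⟩, -⟩
  simp only at h1 h2
  simp only [Finset.coe_product, Finset.coe_range, Set.mem_prod, Set.mem_Iio]
  omega

/-- Functions that become polynomial after multiplication by powers of `z - w p`, `p ∈ S`, are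
closed under finite products. -/
theorem exists_prod_eq_div {ι κ K : Type*} [Field K] (S : Finset ι) (w : ι → K) (T : Finset κ)
    (f : κ → RatFunc K)
    (hf : ∀ u ∈ T, ∃ (P : Polynomial K) (N : ι → ℕ),
      f u = algebraMap (Polynomial K) (RatFunc K) P /
        ∏ p ∈ S, (RatFunc.X - RatFunc.C (w p)) ^ N p) :
    ∃ (P : Polynomial K) (N : ι → ℕ),
      ∏ u ∈ T, f u = algebraMap (Polynomial K) (RatFunc K) P /
        ∏ p ∈ S, (RatFunc.X - RatFunc.C (w p)) ^ N p := by
  refine Finset.prod_induction f (fun g => ∃ (P : Polynomial K) (N : ι → ℕ),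
    g = algebraMap (Polynomial K) (RatFunc K) P /
      ∏ p ∈ S, (RatFunc.X - RatFunc.C (w p)) ^ N p) ?_ ⟨1, 0, by simp⟩ hf
  rintro _ _ ⟨P, N, rfl⟩ ⟨P', N', rfl⟩
  refine ⟨P * P', N + N', ?_⟩
  simp only [map_mul, Pi.add_apply, pow_add, Finset.prod_mul_distrib]
  rw [div_mul_div_comm]

/-- **Poles of `h_Π(z)` lie at the weights of the addible and removable pairs of the
pyramid partition `Π`**: the set `AddP(Π) ∪ RemP(Π)` is finite, and there are a
polynomial `P ∈ K[z]` and natural numbers `n_p` with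
`h_Π(z) = P(z) / ∏_{p ∈ AddP(Π) ∪ RemP(Π)} (z − x_p)^{n_p}`. -/
theorem hPyr_poles_at_addible_removable
    (m : ℕ) (hm : 1 ≤ m) (PB PW : Finset PyrPos) (hPi : IsPyramid m PB PW) :
    ∃ S : Finset PyrPos, (↑S : Set PyrPos) = AddPairs m PB PW ∪ RemPairs m PB PW ∧
      ∃ (P : Polynomial KP) (N : PyrPos → ℕ),
        hPyr m PB PW
          = algebraMap (Polynomial KP) (RatFunc KP) P /
              ∏ p ∈ S, (RatFunc.X - RatFunc.C (posWeight p)) ^ (N p) := by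
  classical
  have hfin := finite_addPairs_union_remPairs m PB PW
  refine ⟨hfin.toFinset, hfin.coe_toFinset, ?_⟩
  obtain ⟨P, N, hPN⟩ := exists_prod_eq_div hfin.toFinset posWeight (hPyrDivisor m PB PW).support
    (fun u => lineFactor u ^ hPyrDivisor m PB PW u) fun u _ => by
      rcases le_or_gt 0 (hPyrDivisor m PB PW u) with hnonneg | hneg
      · obtain ⟨n, hn⟩ := Int.eq_ofNat_of_zero_le hnonneg
        refine ⟨(Polynomial.X - Polynomial.C (chiP - (u.1 : KP) * qP - (u.2 : KP) * hP)) ^ n, 0, ?_⟩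
        rw [hn, zpow_natCast, map_pow, ← RatFunc.X_sub_C_eq_algebraMap, lineFactor]
        simp
      · obtain ⟨n, hn⟩ := Int.eq_ofNat_of_zero_le (neg_nonneg.2 hneg.le)
        obtain ⟨α, β⟩ := u
        have hord := hneg
        rw [hPi.hPyrDivisor_apply] at hord
        obtain ⟨a, b, j, hp, h1, h2⟩ := hPi.exists_mem_addPairs_or_remPairs hm α β hord
        refine ⟨1, Pi.single (a, b, j) n, ?_⟩
        have hfactor : lineFactor (α, β) = RatFunc.X - RatFunc.C (posWeight (a, b, j)) := by
          have := lineFactor_lineClass_add (a, b, j) 0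
          simpa [lineClass, h1, h2] using this
        rw [Finset.prod_eq_single_of_mem (a, b, j) (hfin.mem_toFinset.2 hp)
          fun p _ hne => by rw [Pi.single_eq_of_ne hne, pow_zero], Pi.single_eq_same, hfactor,
          ← neg_neg (hPyrDivisor m PB PW (α, β)), hn, zpow_neg, zpow_natCast, map_one, one_div]
  refine ⟨(-1) ^ (PB \ PW).card * (-1) ^ (m + 1) * P, N, ?_⟩
  rw [hPyr_eq_linePow, linePow, Finsupp.prod, hPN, mul_div_assoc']
  simp
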